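/- arXiv:2406.15433 — 4 statements merged into one kernel-verified Lean document; each statement's English description precedes it below -/
import Mathlib

section
/- Let X be a compact metric space, f : X → X a continuous map, C a chain component of f and D ∈ 𝒟(C). Then V^s(D) = {x ∈ W^s(C) : liminf_{i→∞} d(f^i(x), f^i(D)) = 0}, where d(z, S) = inf_{s∈S} d(z,s) and f^i(D) denotes the image of D under f^i. -/
open Filter Metric Set Topology

section Defs

variable {X : Type*} [MetricSpace X]

/-- A δ-chain of `f` of length `k` (with `k ≥ 1`) within the set `C`, from `x` to `y`. -/
def ChainIn (f : X → X) (C : Set X) (δ : ℝ) (k : ℕ) (x y : X) : Prop :=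
  1 ≤ k ∧ ∃ c : ℕ → X, c 0 = x ∧ c k = y ∧ (∀ i ≤ k, c i ∈ C) ∧
    ∀ i < k, dist (f (c i)) (c (i + 1)) ≤ δ

/-- `x → y` : for every `δ > 0` there is a `δ`-chain of `f` from `x` to `y`. -/
def ChainReach (f : X → X) (x y : X) : Prop :=
  ∀ δ > 0, ∃ k, ChainIn f Set.univ δ k x y

/-- `x` is chain recurrent for `f`. -/
def ChainRecurrent (f : X → X) (x : X) : Prop := ChainReach f x x

/-- `C` is a chain component of `f`: an equivalence class of the relation `↔`
on the set of chain recurrent points. -/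
def IsChainComponent (f : X → X) (C : Set X) : Prop :=
  ∃ x, ChainRecurrent f x ∧
    C = {y | ChainRecurrent f y ∧ ChainReach f x y ∧ ChainReach f y x}

/-- The set of lengths of δ-cycles of `f` restricted to `C`. -/
def cycleLengths (f : X → X) (C : Set X) (δ : ℝ) : Set ℕ :=
  {k | ∃ x ∈ C, ChainIn f C δ k x x}

/-- The greatest common divisor of a set of natural numbers
(the greatest natural number dividing every element). -/
noncomputable def setGcd (S : Set ℕ) : ℕ := sSup {d | ∀ k ∈ S, d ∣ k}

/-- `x ∼_{C,δ} y` : there is a δ-chain of `f|_C` from `x` to `y` whose length is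
divisible by `m(C,δ)`, the gcd of the lengths of all δ-cycles of `f|_C`. -/
def SimCd (f : X → X) (C : Set X) (δ : ℝ) (x y : X) : Prop :=
  ∃ k, setGcd (cycleLengths f C δ) ∣ k ∧ ChainIn f C δ k x y

/-- `x ∼_C y` : `x ∼_{C,δ} y` for all `δ > 0`. -/
def SimC (f : X → X) (C : Set X) (x y : X) : Prop :=
  ∀ δ > 0, SimCd f C δ x y

/-- `𝒟(C,δ)` : the set of equivalence classes of `∼_{C,δ}`. -/
def DClassesd (f : X → X) (C : Set X) (δ : ℝ) : Set (Set X) :=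
  {D | ∃ x ∈ C, D = {y ∈ C | SimCd f C δ x y}}

/-- `𝒟(C)` : the set of equivalence classes of `∼_C`. -/
def DClasses (f : X → X) (C : Set X) : Set (Set X) :=
  {D | ∃ x ∈ C, D = {y ∈ C | SimC f C x y}}

/-- `W^s(C) = {x : lim_{i→∞} d(f^i(x), C) = 0}`. -/
def wStable (f : X → X) (C : Set X) : Set X :=
  {x | Tendsto (fun i => infDist (f^[i] x) C) atTop (nhds 0)}

/-- `V^s(D) = ⋂_{δ>0} {x ∈ W^s(C) : lim_{i→∞} d(f^i(x), f^i(D_δ)) = 0}`, where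
`D_δ` is the unique element of `𝒟(C,δ)` containing `D`. -/
def vStable (f : X → X) (C D : Set X) : Set X :=
  {x | x ∈ wStable f C ∧ ∀ δ > 0, ∀ Dd ∈ DClassesd f C δ, D ⊆ Dd →
    Tendsto (fun i => infDist (f^[i] x) (f^[i] '' Dd)) atTop (nhds 0)}

/-- The s-limit shadowing property. -/
def SLimitShadowing (f : X → X) : Prop :=
  ∀ ε > 0, ∃ δ > 0, ∀ x : ℕ → X,
    (∀ i, dist (f (x i)) (x (i + 1)) ≤ δ) →
    Tendsto (fun i => dist (f (x i)) (x (i + 1))) atTop (nhds 0) →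
    ∃ z : X, (∀ i, dist (f^[i] z) (x i) ≤ ε) ∧
      Tendsto (fun i => dist (f^[i] z) (x i)) atTop (nhds 0)

/-- The limit shadowing property. -/
def LimitShadowing (f : X → X) : Prop :=
  ∀ x : ℕ → X, Tendsto (fun i => dist (f (x i)) (x (i + 1))) atTop (nhds 0) →
    ∃ z : X, Tendsto (fun i => dist (f^[i] z) (x i)) atTop (nhds 0)

/-- The (plain) shadowing property. -/
def ShadowingProperty (f : X → X) : Prop :=
  ∀ ε > 0, ∃ δ > 0, ∀ x : ℕ → X, (∀ i, dist (f (x i)) (x (i + 1)) ≤ δ) →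
    ∃ z : X, ∀ i, dist (f^[i] z) (x i) ≤ ε

/-- A Furstenberg family: hereditary upward and proper. -/
def FurstenbergFamily (F : Set (Set ℕ)) : Prop :=
  (∀ A B : Set ℕ, A ∈ F → A ⊆ B → B ∈ F) ∧ F.Nonempty ∧ F ≠ Set.univ

/-- A full Furstenberg family. -/
def FullFamily (F : Set (Set ℕ)) : Prop :=
  ∀ A ∈ F, ∀ n : ℕ, {i ∈ A | n ≤ i} ∈ F

/-- A translation invariant Furstenberg family. -/
def TranslationInvariantFamily (F : Set (Set ℕ)) : Prop :=
  ∀ A ∈ F, ∀ n : ℕ, ((fun i => i + n) '' A ∈ F ∧ {i | i + n ∈ A} ∈ F)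

/-- `S_f(x₁,…,xₙ; r) = {i : min_{j<k} d(fⁱ(x_j), fⁱ(x_k)) > r}`. -/
def Sset (f : X → X) {n : ℕ} (x : Fin n → X) (r : ℝ) : Set ℕ :=
  {i | ∀ j k : Fin n, j < k → r < dist (f^[i] (x j)) (f^[i] (x k))}

/-- `T_f(x₁,…,xₙ; r) = {i : max_{j<k} d(fⁱ(x_j), fⁱ(x_k)) < r}`. -/
def Tset (f : X → X) {n : ℕ} (x : Fin n → X) (r : ℝ) : Set ℕ :=
  {i | ∀ j k : Fin n, j < k → dist (f^[i] (x j)) (f^[i] (x k)) < r}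

/-- `(x₁,…,xₙ)` is an `(ℱ,𝒢)`-δ-scrambled n-tuple for `f`. -/
def Scrambled (f : X → X) (F G : Set (Set ℕ)) (δ : ℝ) {n : ℕ} (x : Fin n → X) : Prop :=
  Sset f x δ ∈ F ∧ ∀ ε > 0, Tset f x ε ∈ G

/-- `Y` is dense `(ℱ,𝒢)`-n-δ-chaotic for `f`: the `(ℱ,𝒢)`-δ-scrambled n-tuples in `Yⁿ`
form a dense subset of `Yⁿ`. -/
def DenseChaotic (f : X → X) (F G : Set (Set ℕ)) (n : ℕ) (δ : ℝ) (Y : Set X) : Prop :=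
  {x : Fin n → X | ∀ j, x j ∈ Y} ⊆
    closure {x : Fin n → X | (∀ j, x j ∈ Y) ∧ Scrambled f F G δ x}

/-- `S` is a residual subset of the subspace `T`: it contains a countable intersection of
dense open subsets of `T`. -/
def ResidualIn {α : Type*} [TopologicalSpace α] (T S : Set α) : Prop :=
  ∃ U : ℕ → Set α, (∀ i, IsOpen (U i)) ∧ (∀ i, T ⊆ closure (U i ∩ T)) ∧
    (⋂ i, U i) ∩ T ⊆ S

/-- `Y` is generic `(ℱ,𝒢)`-n-δ-chaotic for `f`: the `(ℱ,𝒢)`-δ-scrambled n-tuples in `Yⁿ`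
form a residual subset of `Yⁿ`. -/
def GenericChaotic (f : X → X) (F G : Set (Set ℕ)) (n : ℕ) (δ : ℝ) (Y : Set X) : Prop :=
  ResidualIn {x : Fin n → X | ∀ j, x j ∈ Y}
    {x : Fin n → X | (∀ j, x j ∈ Y) ∧ Scrambled f F G δ x}

/-- A Furstenberg family `F` is compatible with `(Z, g)`. -/
def CompatibleFamily {Z : Type*} [TopologicalSpace Z] (F : Set (Set ℕ)) (g : Z → Z) : Prop :=
  ∀ U : Set Z, IsOpen U → IsGδ {z | {i | g^[i] z ∈ U} ∈ F}

end Defs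

section ChainComponents

variable {X : Type*} [MetricSpace X] {f : X → X} {C : Set X} {δ : ℝ} {x y z : X} {k l : ℕ}

namespace ChainIn

theorem mono {C' : Set X} {δ' : ℝ} (h : ChainIn f C δ k x y) (hC : C ⊆ C') (hδ : δ ≤ δ') :
    ChainIn f C' δ' k x y := by
  obtain ⟨hk, c, h0, h1, hc, hd⟩ := h
  exact ⟨hk, c, h0, h1, fun i hi => hC (hc i hi), fun i hi => (hd i hi).trans hδ⟩

theorem trans (h : ChainIn f C δ k x y) (h' : ChainIn f C δ l y z) :
    ChainIn f C δ (k + l) x z := by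
  obtain ⟨hk, c, h0, h1, hc, hd⟩ := h
  obtain ⟨hl, c', h0', h1', hc', hd'⟩ := h'
  refine ⟨by omega, fun i => if i ≤ k then c i else c' (i - k), by simp [h0], ?_, ?_, ?_⟩
  · simp [show ¬ k + l ≤ k by omega, h1']
  · intro i hi
    dsimp only
    split_ifs with h
    · exact hc i h
    · exact hc' _ (by omega)
  · intro i hi
    dsimp only
    rcases lt_trichotomy i k with h | rfl | h
    · rw [if_pos h.le, if_pos (by omega)]
      exact hd i h
    · rw [if_pos le_rfl, if_neg (by omega), h1, ← h0']
      simpa using hd' 0 (by omega)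
    · rw [if_neg (by omega), if_neg (by omega), show i + 1 - k = i - k + 1 by omega]
      exact hd' _ (by omega)

theorem of_seq {c : ℕ → X} (hc : ∀ i ≤ k, c i ∈ C)
    (hd : ∀ i < k, dist (f (c i)) (c (i + 1)) ≤ δ) {a b : ℕ} (hab : a < b) (hb : b ≤ k) :
    ChainIn f C δ (b - a) (c a) (c b) := by
  refine ⟨by omega, fun i => c (a + i), by simp, ?_, fun i hi => hc _ (by omega),
    fun i hi => hd _ (by omega)⟩
  dsimp only
  congr 1
  omega

theorem iterate (hf : MapsTo f C C) (hδ : 0 ≤ δ) (hx : x ∈ C) (hk : 1 ≤ k) :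
    ChainIn f C δ k x (f^[k] x) :=
  ⟨hk, fun i => f^[i] x, rfl, rfl, fun i _ => hf.iterate i hx, fun i _ => by
    simpa [Function.iterate_succ_apply'] using hδ⟩

theorem of_dist_le {η ε : ℝ} (h : ChainIn f C η k x y) (hz : z ∈ C) (hyz : dist y z ≤ ε)
    (hη : η + ε ≤ δ) (hη' : η ≤ δ) : ChainIn f C δ k x z := by
  obtain ⟨hk, c, h0, h1, hc, hd⟩ := h
  refine ⟨hk, fun i => if i = k then z else c i, by simp [h0, show 0 ≠ k by omega],
    by simp, ?_, ?_⟩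
  · intro i hi
    dsimp only
    split_ifs
    · exact hz
    · exact hc i hi
  · intro i hi
    dsimp only
    rw [if_neg hi.ne]
    split_ifs with h
    · have := hd i hi
      rw [h, h1] at this
      linarith [dist_triangle (f (c i)) y z]
    · exact (hd i hi).trans hη'

/-- Chains are stable under small perturbations of all their points. -/
theorem exists_perturb [CompactSpace X] (hf : Continuous f) (hδ : 0 < δ) :
    ∃ η > 0, ∀ (C : Set X) (k : ℕ) (c c' : ℕ → X), 1 ≤ k →
      (∀ i < k, dist (f (c i)) (c (i + 1)) ≤ η) → (∀ i ≤ k, dist (c i) (c' i) < η) →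
      (∀ i ≤ k, c' i ∈ C) → ChainIn f C δ k (c' 0) (c' k) := by
  obtain ⟨η, hη, h⟩ := Metric.uniformContinuous_iff.1
    (CompactSpace.uniformContinuous_of_continuous hf) (δ / 3) (by positivity)
  refine ⟨min η (δ / 3), by positivity, fun C k c c' hk hd hcc hC => ⟨hk, c', rfl, rfl, hC, ?_⟩⟩
  intro i hi
  have h1 := h ((hcc i hi.le).trans_le (min_le_left _ _))
  have h2 := (hd i hi).trans (min_le_right _ _)
  have h3 := (hcc (i + 1) hi).le.trans (min_le_right _ _)
  rw [dist_comm] at h1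
  linarith [dist_triangle4 (f (c' i)) (f (c i)) (c (i + 1)) (c' (i + 1))]

theorem exists_perturb_ends [CompactSpace X] (hf : Continuous f) (hδ : 0 < δ) :
    ∃ η > 0, ∀ (k : ℕ) (x y x' y' : X), ChainIn f univ η k x y → dist x x' < η →
      dist y y' < η → ChainIn f univ δ k x' y' := by
  obtain ⟨η, hη, h⟩ := exists_perturb hf hδ
  refine ⟨η, hη, ?_⟩
  rintro k x y x' y' ⟨hk, c, rfl, rfl, -, hd⟩ hx hy
  have := h univ k c (fun i => if i = 0 then x' else if i = k then y' else c i) hk hd ?_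
    (fun _ _ => mem_univ _)
  · simpa [show k ≠ 0 by omega] using this
  · intro i hi
    split_ifs with h0 h1
    · rwa [h0]
    · rwa [h1]
    · simpa using hη

end ChainIn

namespace ChainReach

theorem trans (h : ChainReach f x y) (h' : ChainReach f y z) : ChainReach f x z := fun δ hδ => by
  obtain ⟨k, hk⟩ := h δ hδ
  obtain ⟨l, hl⟩ := h' δ hδ
  exact ⟨_, hk.trans hl⟩

theorem of_tendsto [CompactSpace X] (hf : Continuous f) {u v : ℕ → X} {e : ℕ → ℝ}
    (he : Tendsto e atTop (𝓝 0)) (hu : Tendsto u atTop (𝓝 x)) (hv : Tendsto v atTop (𝓝 y))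
    (h : ∀ n, ∃ k, ChainIn f univ (e n) k (u n) (v n)) : ChainReach f x y := fun δ hδ => by
  obtain ⟨η, hη, H⟩ := ChainIn.exists_perturb_ends hf hδ
  obtain ⟨n, h1, h2, h3⟩ := ((he.eventually_lt_const hη).and
    ((Metric.tendsto_nhds.1 hu η hη).and (Metric.tendsto_nhds.1 hv η hη))).exists
  obtain ⟨k, hk⟩ := h n
  exact ⟨k, H k _ _ _ _ (hk.mono subset_rfl h1.le) h2 h3⟩

theorem map_left [CompactSpace X] (hf : Continuous f) (h : ChainReach f x x) :
    ChainReach f (f x) x := fun δ hδ => by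
  obtain ⟨η, hη, H⟩ := ChainIn.exists_perturb_ends hf hδ
  obtain ⟨k, hk⟩ := h (η / 2) (by positivity)
  obtain ⟨hk2, c, h0, h1, hc, hd⟩ := hk.trans hk
  have hk1 := hk.1
  refine ⟨k + k - 1, H _ (c 1) x _ _ ?_ ?_ (by simpa using hη)⟩
  · have := ChainIn.of_seq hc hd (a := 1) (b := k + k) (by omega) le_rfl
    rw [h1] at this
    exact this.mono subset_rfl (by linarith)
  · have := hd 0 (by omega)
    rw [h0, zero_add] at this
    rw [dist_comm]
    linarith

end ChainReach

namespace IsChainComponent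

theorem reach (hC : IsChainComponent f C) (hx : x ∈ C) (hy : y ∈ C) : ChainReach f x y := by
  obtain ⟨p, -, rfl⟩ := hC
  exact hx.2.2.trans hy.2.1

theorem mem_of_reach (hC : IsChainComponent f C) (hx : x ∈ C) (h : ChainReach f x y)
    (h' : ChainReach f y x) : y ∈ C := by
  obtain ⟨p, -, rfl⟩ := hC
  exact ⟨h'.trans h, hx.2.1.trans h, h'.trans hx.2.2⟩

theorem nonempty (hC : IsChainComponent f C) : C.Nonempty := by
  obtain ⟨p, hp, rfl⟩ := hC
  exact ⟨p, hp, hp, hp⟩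

variable [CompactSpace X]

theorem isClosed (hf : Continuous f) (hC : IsChainComponent f C) : IsClosed C := by
  refine isClosed_of_closure_subset fun y hy => ?_
  obtain ⟨u, hu, huy⟩ := mem_closure_iff_seq_limit.1 hy
  have hpos (n : ℕ) : (0 : ℝ) < 1 / (n + 1) := Nat.one_div_pos_of_nat
  refine hC.mem_of_reach (hu 0) ?_ ?_
  · exact .of_tendsto hf tendsto_one_div_add_atTop_nhds_zero_nat tendsto_const_nhds huy
      fun n => hC.reach (hu 0) (hu n) _ (hpos n)
  · exact .of_tendsto hf tendsto_one_div_add_atTop_nhds_zero_nat huy tendsto_const_nhds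
      fun n => hC.reach (hu n) (hu 0) _ (hpos n)

theorem mapsTo (hf : Continuous f) (hC : IsChainComponent f C) : MapsTo f C C := fun x hx =>
  hC.mem_of_reach hx
    (fun δ hδ => ⟨1, by
      simpa using ChainIn.iterate (f := f) (mapsTo_univ f univ) hδ.le (mem_univ x) le_rfl⟩)
    ((hC.reach hx hx).map_left hf)

/-- Fine cycles through a point of a chain component stay close to it. -/
theorem exists_infDist_lt (hf : Continuous f) (hC : IsChainComponent f C) (hx : x ∈ C)
    (hy : y ∈ C) {ε : ℝ} (hε : 0 < ε) :
    ∃ η > 0, ∀ z k l, ChainIn f univ η k x z → ChainIn f univ η l z y → infDist z C < ε := by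
  by_contra! H
  choose z k l h1 h2 h3 using fun n : ℕ => H (1 / (n + 1)) Nat.one_div_pos_of_nat
  obtain ⟨w, φ, hφ, hw⟩ := CompactSpace.tendsto_subseq z
  have he := tendsto_one_div_add_atTop_nhds_zero_nat (𝕜 := ℝ) |>.comp hφ.tendsto_atTop
  have hwC : w ∈ C := by
    refine hC.mem_of_reach hx (.of_tendsto hf he tendsto_const_nhds hw fun n => ⟨_, h1 _⟩) ?_
    exact ChainReach.trans (.of_tendsto hf he hw tendsto_const_nhds fun n => ⟨_, h2 _⟩)
      (hC.reach hy hx)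
  have := (continuous_infDist_pt C).tendsto w |>.comp hw
  rw [infDist_zero_of_mem hwC] at this
  obtain ⟨n, hn⟩ := (this.eventually_lt_const hε).exists
  exact hn.not_ge (h3 _)

/-- The restriction of `f` to a chain component is chain transitive. -/
theorem exists_chainIn (hf : Continuous f) (hC : IsChainComponent f C) (hx : x ∈ C)
    (hy : y ∈ C) (hδ : 0 < δ) : ∃ k, ChainIn f C δ k x y := by
  obtain ⟨η, hη, H⟩ := ChainIn.exists_perturb hf hδ
  obtain ⟨θ, hθ, H'⟩ := hC.exists_infDist_lt hf hx hy hη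
  obtain ⟨k, hk, c, h0, h1, hc, hd⟩ := hC.reach hx hy (min η θ) (by positivity)
  have hnear : ∀ i, ∃ w ∈ C, i ≤ k → dist (c i) w < η ∧ (i = 0 → w = x) ∧ (i = k → w = y) := by
    intro i
    rcases Nat.eq_zero_or_pos i with rfl | hi
    · exact ⟨x, hx, fun _ => ⟨by simpa [h0], fun _ => rfl, fun h => by omega⟩⟩
    rcases lt_trichotomy i k with hik | rfl | hik
    · have a1 := (ChainIn.of_seq hc hd hi hik.le).mono subset_rfl (min_le_right _ _)
      have a2 := (ChainIn.of_seq hc hd hik le_rfl).mono subset_rfl (min_le_right _ _)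
      rw [h0] at a1
      rw [h1] at a2
      obtain ⟨w, hw, hlt⟩ := (infDist_lt_iff ⟨x, hx⟩).1 (H' _ _ _ a1 a2)
      exact ⟨w, hw, fun _ => ⟨hlt, by omega, by omega⟩⟩
    · exact ⟨y, hy, fun _ => ⟨by simpa [h1], by omega, fun _ => rfl⟩⟩
    · exact ⟨x, hx, by omega⟩
  choose c' hc' h' using hnear
  have := H C k c c' hk (fun i hi => (hd i hi).trans (min_le_left _ _))
    (fun i hi => (h' i hi).1) (fun i _ => hc' i)
  rw [(h' 0 (by omega)).2.1 rfl, (h' k le_rfl).2.2 rfl] at this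
  exact ⟨k, this⟩

theorem surjOn (hf : Continuous f) (hC : IsChainComponent f C) : SurjOn f C C := by
  intro y hy
  rw [← ((hC.isClosed hf).isCompact.image hf).isClosed.closure_eq, Metric.mem_closure_iff]
  intro ε hε
  obtain ⟨k, hk, c, h0, h1, hc, hd⟩ := hC.exists_chainIn hf hy hy (half_pos hε)
  refine ⟨_, mem_image_of_mem f (hc (k - 1) (by omega)), ?_⟩
  have := hd (k - 1) (by omega)
  rw [show k - 1 + 1 = k by omega, h1] at this
  rw [dist_comm]
  linarith

end IsChainComponent

theorem dvd_setGcd_iff {S : Set ℕ} {n d : ℕ} (hn : n ∈ S) (hn0 : 0 < n) :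
    d ∣ setGcd S ↔ ∀ k ∈ S, d ∣ k := by
  have hb : BddAbove {d | ∀ k ∈ S, d ∣ k} := ⟨n, fun d hd => Nat.le_of_dvd hn0 (hd n hn)⟩
  have hm : ∀ k ∈ S, setGcd S ∣ k :=
    Nat.sSup_mem (s := {d | ∀ k ∈ S, d ∣ k}) ⟨1, fun k _ => one_dvd k⟩ hb
  refine ⟨fun h k hk => h.trans (hm k hk), fun h => ?_⟩
  have hle : d.lcm (setGcd S) ≤ setGcd S :=
    le_csSup hb fun k hk => Nat.lcm_dvd (h k hk) (hm k hk)
  have hpos : 0 < setGcd S := Nat.pos_of_dvd_of_pos (hm n hn) hn0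
  have : d.lcm (setGcd S) = setGcd S :=
    hle.antisymm (Nat.le_of_dvd (Nat.pos_of_dvd_of_pos (Nat.lcm_dvd (h n hn) (hm n hn)) hn0)
      (Nat.dvd_lcm_right _ _))
  exact this ▸ Nat.dvd_lcm_left _ _

namespace IsChainComponent

variable [CompactSpace X]

theorem dvd_setGcd_cycleLengths_iff (hf : Continuous f) (hC : IsChainComponent f C) (hδ : 0 < δ)
    {d : ℕ} : d ∣ setGcd (cycleLengths f C δ) ↔ ∀ k ∈ cycleLengths f C δ, d ∣ k := by
  obtain ⟨p, hp⟩ := hC.nonempty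
  obtain ⟨k, hk⟩ := hC.exists_chainIn hf hp hp hδ
  exact dvd_setGcd_iff ⟨p, hp, hk⟩ hk.1

theorem setGcd_dvd_of_cycle (hf : Continuous f) (hC : IsChainComponent f C) (hδ : 0 < δ)
    (hx : x ∈ C) (h : ChainIn f C δ k x x) : setGcd (cycleLengths f C δ) ∣ k :=
  (hC.dvd_setGcd_cycleLengths_iff hf hδ).1 dvd_rfl k ⟨x, hx, h⟩

theorem simCd_of_dist_le (hf : Continuous f) (hC : IsChainComponent f C) (hδ : 0 < δ)
    (hx : x ∈ C) (hy : y ∈ C) (h : dist x y ≤ δ / 2) : SimCd f C δ x y := by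
  obtain ⟨k, hk⟩ := hC.exists_chainIn hf hx hx (half_pos hδ)
  exact ⟨k, hC.setGcd_dvd_of_cycle hf hδ hx (hk.mono subset_rfl (by linarith)),
    hk.of_dist_le hy h (by linarith) (by linarith)⟩

theorem simCd_refl (hf : Continuous f) (hC : IsChainComponent f C) (hδ : 0 < δ)
    (hx : x ∈ C) : SimCd f C δ x x :=
  hC.simCd_of_dist_le hf hδ hx hx (by rw [dist_self]; positivity)

theorem simCd_symm (hf : Continuous f) (hC : IsChainComponent f C) (hδ : 0 < δ)
    (hx : x ∈ C) (hy : y ∈ C) (h : SimCd f C δ x y) : SimCd f C δ y x := by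
  obtain ⟨k, hk, h⟩ := h
  obtain ⟨l, hl⟩ := hC.exists_chainIn hf hy hx hδ
  exact ⟨l, (Nat.dvd_add_right hk).1 (hC.setGcd_dvd_of_cycle hf hδ hx (h.trans hl)), hl⟩

end IsChainComponent

theorem SimCd.trans (h : SimCd f C δ x y) (h' : SimCd f C δ y z) : SimCd f C δ x z := by
  obtain ⟨k, hk, h⟩ := h
  obtain ⟨l, hl, h'⟩ := h'
  exact ⟨_, dvd_add hk hl, h.trans h'⟩

namespace IsChainComponent

variable [CompactSpace X]

theorem simCd_mono (hf : Continuous f) (hC : IsChainComponent f C) {δ' : ℝ} (hδ' : 0 < δ')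
    (hle : δ' ≤ δ) (h : SimCd f C δ' x y) : SimCd f C δ x y := by
  obtain ⟨k, hk, h⟩ := h
  refine ⟨k, dvd_trans ?_ hk, h.mono subset_rfl hle⟩
  rw [hC.dvd_setGcd_cycleLengths_iff hf hδ']
  rintro l ⟨z, hz, hl⟩
  exact hC.setGcd_dvd_of_cycle hf (hδ'.trans_le hle) hz (hl.mono subset_rfl hle)

theorem simCd_iterate_of_chainIn (hf : Continuous f) (hC : IsChainComponent f C) (hδ : 0 < δ)
    (hx : x ∈ C) (h : ChainIn f C δ k x y) (N : ℕ) :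
    SimCd f C δ (f^[k + N * setGcd (cycleLengths f C δ)] x) y := by
  set m := setGcd (cycleLengths f C δ)
  have hk := h.1
  obtain ⟨l, hl⟩ := hC.exists_chainIn hf ((hC.mapsTo hf).iterate (k + N * m) hx) hx hδ
  have h1 := hC.setGcd_dvd_of_cycle hf hδ hx
    ((ChainIn.iterate (hC.mapsTo hf) hδ.le hx (by omega)).trans hl)
  refine ⟨l + k, ?_, hl.trans h⟩
  rw [show k + N * m + l = N * m + (l + k) by ring] at h1
  exact (Nat.dvd_add_right (dvd_mul_left _ _)).1 h1

theorem simCd_map_iff (hf : Continuous f) (hC : IsChainComponent f C) (hδ : 0 < δ)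
    (hx : x ∈ C) (hy : y ∈ C) : SimCd f C δ (f x) (f y) ↔ SimCd f C δ x y := by
  have hm := hC.mapsTo hf
  have hxx : ChainIn f C δ 1 x (f x) := .iterate hm hδ.le hx le_rfl
  have hyy : ChainIn f C δ 1 y (f y) := .iterate hm hδ.le hy le_rfl
  obtain ⟨a, ha⟩ := hC.exists_chainIn hf (hm hx) hx hδ
  obtain ⟨b, hb⟩ := hC.exists_chainIn hf (hm hy) hy hδ
  have h1 := hC.setGcd_dvd_of_cycle hf hδ hx (hxx.trans ha)
  have h2 := hC.setGcd_dvd_of_cycle hf hδ hy (hyy.trans hb)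
  constructor
  · rintro ⟨k, hk, h⟩
    refine ⟨_, ?_, (hxx.trans h).trans hb⟩
    rw [show 1 + k + b = k + (1 + b) by ring]
    exact dvd_add hk h2
  · rintro ⟨k, hk, h⟩
    refine ⟨_, ?_, (ha.trans h).trans hyy⟩
    rw [show a + k + 1 = k + (1 + a) by ring]
    exact dvd_add hk h1

theorem simCd_iterate_iff (hf : Continuous f) (hC : IsChainComponent f C) (hδ : 0 < δ)
    (hx : x ∈ C) (hy : y ∈ C) (i : ℕ) :
    SimCd f C δ (f^[i] x) (f^[i] y) ↔ SimCd f C δ x y := by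
  induction i with
  | zero => rfl
  | succ i ih =>
    have hm := (hC.mapsTo hf).iterate i
    rw [Function.iterate_succ_apply', Function.iterate_succ_apply',
      hC.simCd_map_iff hf hδ (hm hx) (hm hy), ih]

theorem image_iterate_simCd (hf : Continuous f) (hC : IsChainComponent f C) (hδ : 0 < δ)
    (hx : x ∈ C) (i : ℕ) :
    f^[i] '' {y ∈ C | SimCd f C δ x y} = {y ∈ C | SimCd f C δ (f^[i] x) y} := by
  ext y
  constructor
  · rintro ⟨z, ⟨hz, hxz⟩, rfl⟩
    exact ⟨(hC.mapsTo hf).iterate i hz, (hC.simCd_iterate_iff hf hδ hx hz i).2 hxz⟩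
  · rintro ⟨hy, h⟩
    obtain ⟨z, hz, rfl⟩ := (hC.surjOn hf).iterate i hy
    exact ⟨z, ⟨hz, (hC.simCd_iterate_iff hf hδ hx hz i).1 h⟩, rfl⟩

theorem isClosed_simCd (hf : Continuous f) (hC : IsChainComponent f C) (hδ : 0 < δ) :
    IsClosed {y ∈ C | SimCd f C δ x y} := by
  refine isClosed_of_closure_subset fun y hy => ?_
  have hyC : y ∈ C := closure_minimal (fun _ h => h.1) (hC.isClosed hf) hy
  obtain ⟨z, hz, hyz⟩ := Metric.mem_closure_iff.1 hy (δ / 2) (half_pos hδ)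
  exact ⟨hyC, hz.2.trans (hC.simCd_of_dist_le hf hδ hz.1 hyC (by rw [dist_comm]; exact hyz.le))⟩

theorem infDist_iterate_succ_lt (hf : Continuous f) (hC : IsChainComponent f C) (hδ : 0 < δ) :
    ∃ β > 0, ∀ β' ≤ β, ∀ x y, y ∈ C → infDist x {z ∈ C | SimCd f C δ y z} < β' →
      infDist (f x) C < β' → infDist (f x) {z ∈ C | SimCd f C δ (f y) z} < β' := by
  obtain ⟨β, hβ, h⟩ := Metric.uniformContinuous_iff.1
    (CompactSpace.uniformContinuous_of_continuous hf) (δ / 4) (by positivity)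
  refine ⟨min β (δ / 4), by positivity, fun β' hβ' x y hy h1 h2 => ?_⟩
  obtain ⟨u, ⟨hu, hyu⟩, hxu⟩ := (infDist_lt_iff (s := {z ∈ C | SimCd f C δ y z})
    ⟨y, hy, hC.simCd_refl hf hδ hy⟩).1 h1
  obtain ⟨v, hv, hxv⟩ := (infDist_lt_iff hC.nonempty).1 h2
  have hfu := h (hxu.trans_le (hβ'.trans (min_le_left _ _)))
  have hfu' := hxv.trans_le (hβ'.trans (min_le_right _ _))
  have huv : SimCd f C δ (f u) v := hC.simCd_of_dist_le hf hδ (hC.mapsTo hf hu) hv (by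
    linarith [dist_triangle_left (f u) v (f x)])
  have hvmem : v ∈ {z ∈ C | SimCd f C δ (f y) z} :=
    ⟨hv, ((hC.simCd_map_iff hf hδ hy hu).2 hyu).trans huv⟩
  exact (infDist_le_dist_of_mem hvmem).trans_lt hxv

theorem tendsto_infDist_of_frequently (hf : Continuous f) (hC : IsChainComponent f C)
    (hδ : 0 < δ) (hx : x ∈ wStable f C) (hy : y ∈ C)
    (h : ∀ ε > 0, ∃ᶠ i in atTop, infDist (f^[i] x) {z ∈ C | SimCd f C δ (f^[i] y) z} < ε) :
    Tendsto (fun i => infDist (f^[i] x) {z ∈ C | SimCd f C δ (f^[i] y) z}) atTop (𝓝 0) := by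
  obtain ⟨β, hβ, H⟩ := hC.infDist_iterate_succ_lt hf hδ
  refine Metric.tendsto_atTop.2 fun ε hε => ?_
  have hpos : 0 < min β ε := by positivity
  obtain ⟨N, hN⟩ := eventually_atTop.1 (Tendsto.eventually_lt_const hpos hx)
  obtain ⟨n, hn, hlt⟩ := frequently_atTop.1 (h _ hpos) N
  refine ⟨n, fun i hi => ?_⟩
  suffices infDist (f^[i] x) {z ∈ C | SimCd f C δ (f^[i] y) z} < min β ε by
    rw [Real.dist_0_eq_abs, abs_of_nonneg infDist_nonneg]
    exact this.trans_le (min_le_right _ _)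
  induction i, hi using Nat.le_induction with
  | base => exact hlt
  | succ i hi ih =>
    have hC' := hN (i + 1) (by omega)
    simp only [Function.iterate_succ_apply'] at hC' ⊢
    exact H _ (min_le_left _ _) _ _ ((hC.mapsTo hf).iterate i hy) ih hC'

/-- Among the classes of all scales there is one all of whose subclasses meet the same members of
a given finite family of sets. -/
theorem exists_minimal_class (hf : Continuous f) (hC : IsChainComponent f C) {ι : Type*}
    (t : Finset ι) (U : ι → Set X) :
    ∃ δ > 0, ∃ q ∈ C, ∀ a ∈ t, ({z ∈ C | SimCd f C δ q z} ∩ U a).Nonempty →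
      ∀ δ' > 0, δ' ≤ δ → ∀ q' ∈ C, SimCd f C δ q q' →
        ({z ∈ C | SimCd f C δ' q' z} ∩ U a).Nonempty := by
  classical
  let S (δ : ℝ) (q : X) : Finset ι := {a ∈ t | ({z ∈ C | SimCd f C δ q z} ∩ U a).Nonempty}
  obtain ⟨p, hp⟩ := hC.nonempty
  have hex : ∃ n, ∃ δ > 0, ∃ q ∈ C, (S δ q).card = n := ⟨_, 1, one_pos, p, hp, rfl⟩
  obtain ⟨δ, hδ, q, hq, hcard⟩ := Nat.find_spec hex
  refine ⟨δ, hδ, q, hq, fun a ha hne δ' hδ' hle q' hq' hqq' => ?_⟩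
  have hsub : S δ' q' ⊆ S δ q := Finset.monotone_filter_right t fun b _ hb =>
    hb.mono (inter_subset_inter_left _ fun z hz =>
      ⟨hz.1, hqq'.trans (hC.simCd_mono hf hδ' hle hz.2)⟩)
  have heq : S δ' q' = S δ q := Finset.eq_of_subset_of_card_le hsub
    (hcard ▸ Nat.find_min' hex ⟨δ', hδ', q', hq', rfl⟩)
  have : a ∈ S δ q := Finset.mem_filter.2 ⟨ha, hne⟩
  rw [← heq] at this
  exact (Finset.mem_filter.1 this).2

/-- A closed set meeting the class of a point at every small scale meets the intersection of
these classes. -/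
theorem exists_simC_mem (hf : Continuous f) (hC : IsChainComponent f C) {K : Set X}
    (hK : IsClosed K) (hδ : 0 < δ)
    (h : ∀ δ' > 0, δ' ≤ δ → ({z ∈ C | SimCd f C δ' x z} ∩ K).Nonempty) :
    ({z ∈ C | SimC f C x z} ∩ K).Nonempty := by
  have hpos (n : ℕ) : 0 < min δ (1 / (n + 1)) := lt_min hδ Nat.one_div_pos_of_nat
  choose z hz hzK using fun n : ℕ => h _ (hpos n) (min_le_left _ _)
  obtain ⟨w, φ, hφ, hw⟩ := CompactSpace.tendsto_subseq z
  have he := tendsto_one_div_add_atTop_nhds_zero_nat (𝕜 := ℝ) |>.comp hφ.tendsto_atTop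
  refine ⟨w, ⟨(hC.isClosed hf).mem_of_tendsto hw (.of_forall fun n => (hz _).1), ?_⟩,
    hK.mem_of_tendsto hw (.of_forall fun n => hzK _)⟩
  intro ε hε
  refine ((hC.isClosed_simCd hf hε).mem_of_tendsto hw ?_).2
  filter_upwards [he.eventually_lt_const hε] with n hn
  exact ⟨(hz _).1, hC.simCd_mono hf (hpos _) ((min_le_right _ _).trans hn.le) (hz _).2⟩

theorem exists_infDist_iterate_lt (hf : Continuous f) (hC : IsChainComponent f C) (hy : y ∈ C)
    (hx : ∀ δ > 0, Tendsto (fun i => infDist (f^[i] x) (f^[i] '' {z ∈ C | SimCd f C δ y z}))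
      atTop (𝓝 0)) {ε : ℝ} (hε : 0 < ε) (N : ℕ) :
    ∃ i ≥ N, infDist (f^[i] x) (f^[i] '' {z ∈ C | SimC f C y z}) < ε := by
  have hε' : 0 < ε / 4 := by positivity
  obtain ⟨t, -, ht, hcover⟩ := (isCompact_univ (X := X)).finite_cover_balls hε'
  obtain ⟨δ, hδ, q, hq, H⟩ := hC.exists_minimal_class hf ht.toFinset
    fun a => closedBall a (ε / 4)
  obtain ⟨M, hM⟩ := eventually_atTop.1 ((hx δ hδ).eventually_lt_const hε')
  obtain ⟨k, hk⟩ := hC.exists_chainIn hf hy hq hδ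
  have hm : 0 < setGcd (cycleLengths f C δ) := by
    obtain ⟨l, hl⟩ := hC.exists_chainIn hf hy hy hδ
    exact Nat.pos_of_dvd_of_pos (hC.setGcd_dvd_of_cycle hf hδ hy hl) hl.1
  have hsim := hC.simCd_iterate_of_chainIn hf hδ hy hk (max M N)
  have hi := (Nat.le_mul_of_pos_right (max M N) hm).trans
    (Nat.le_add_left _ k)
  set i := k + max M N * setGcd (cycleLengths f C δ)
  have hyi : f^[i] y ∈ C := (hC.mapsTo hf).iterate i hy
  have hsim' := hC.simCd_symm hf hδ hyi hq hsim
  refine ⟨i, (le_max_right _ _).trans hi, ?_⟩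
  have hyy : y ∈ {z ∈ C | SimCd f C δ y z} := ⟨hy, hC.simCd_refl hf hδ hy⟩
  obtain ⟨u, hu, hxu⟩ := (infDist_lt_iff ⟨_, mem_image_of_mem f^[i] hyy⟩).1
    (hM i ((le_max_left _ _).trans hi))
  rw [hC.image_iterate_simCd hf hδ hy] at hu
  obtain ⟨a, ha, hua⟩ := mem_iUnion₂.1 (hcover (mem_univ u))
  obtain ⟨v, hv, hva⟩ := hC.exists_simC_mem hf (x := y)
    ((isClosed_closedBall (x := a) (ε := ε / 4)).preimage (hf.iterate i)) hδ (by
    intro δ' hδ' hle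
    obtain ⟨w, hw, hwa⟩ := H a (ht.mem_toFinset.2 ha)
      ⟨u, ⟨hu.1, hsim'.trans hu.2⟩, ball_subset_closedBall hua⟩ δ' hδ' hle _ hyi hsim'
    rw [← hC.image_iterate_simCd hf hδ' hy] at hw
    obtain ⟨w, hw, rfl⟩ := hw
    exact ⟨w, hw, hwa⟩)
  refine (infDist_le_dist_of_mem (mem_image_of_mem _ hv)).trans_lt ?_
  have h1 : dist u a < ε / 4 := hua
  have h2 : dist (f^[i] v) a ≤ ε / 4 := hva
  linarith [dist_triangle4_right (f^[i] x) (f^[i] v) u a, dist_triangle (f^[i] x) u (f^[i] v),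
    dist_triangle_right u (f^[i] v) a]

end IsChainComponent

/-- For bounded nonnegative sequences, the lower limit vanishes iff the sequence is frequently
small. -/
theorem liminf_eq_zero_iff_frequently {u : ℕ → ℝ} (h0 : ∀ i, 0 ≤ u i) {B : ℝ}
    (hB : ∀ i, u i ≤ B) : liminf u atTop = 0 ↔ ∀ ε > 0, ∃ᶠ i in atTop, u i < ε := by
  have hbdd : IsBoundedUnder (· ≥ ·) atTop u := isBoundedUnder_of ⟨0, h0⟩
  have hcobdd : IsCoboundedUnder (· ≥ ·) atTop u :=
    (isBoundedUnder_of ⟨B, hB⟩ : IsBoundedUnder (· ≤ ·) atTop u).isCoboundedUnder_ge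
  constructor
  · intro h ε hε
    exact frequently_lt_of_liminf_lt hcobdd (h ▸ hε)
  · intro h
    refine le_antisymm (le_of_forall_pos_le_add fun ε hε => ?_)
      (le_liminf_of_le hcobdd (.of_forall h0))
    rw [zero_add]
    exact liminf_le_of_frequently_le ((h ε hε).mono fun _ hi => hi.le) hbdd

end ChainComponents

/-- Remark 2.5: `V^s(D)` equals the set of points of `W^s(C)` whose orbit
approaches `f^i(D)` along a subsequence. -/
theorem vStable_eq_liminf_description
    {X : Type*} [MetricSpace X] [CompactSpace X] (f : X → X) (hf : Continuous f)
    (C : Set X) (hC : IsChainComponent f C) (D : Set X) (hD : D ∈ DClasses f C) :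
    vStable f C D = {x ∈ wStable f C |
      Filter.liminf (fun i => infDist (f^[i] x) (f^[i] '' D)) atTop = 0} := by
  obtain ⟨p, hp, rfl⟩ := hD
  have hpD : p ∈ {y ∈ C | SimC f C p y} := ⟨hp, fun δ hδ => hC.simCd_refl hf hδ hp⟩
  ext x
  refine and_congr_right fun hx => ?_
  rw [liminf_eq_zero_iff_frequently (fun _ => infDist_nonneg) (B := diam (univ : Set X))
    fun i => (infDist_le_dist_of_mem (mem_image_of_mem _ hpD)).trans
      (dist_le_diam_of_mem isCompact_univ.isBounded (mem_univ _) (mem_univ _))]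
  constructor
  · intro h ε hε
    exact frequently_atTop.2 (hC.exists_infDist_iterate_lt hf hp
      (fun δ hδ => h δ hδ _ ⟨p, hp, rfl⟩ fun y hy => ⟨hy.1, hy.2 δ hδ⟩) hε)
  · rintro h δ hδ _ ⟨q, hq, rfl⟩ hsub
    simp only [hC.image_iterate_simCd hf hδ hq]
    refine hC.tendsto_infDist_of_frequently hf hδ hx hq fun ε hε => (h ε hε).mono fun i hi => ?_
    rw [← hC.image_iterate_simCd hf hδ hq]
    exact (infDist_le_infDist_of_subset (image_mono hsub)
      ⟨_, mem_image_of_mem _ hpD⟩).trans_lt hi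
end

section
/- Let X be a compact metric space and f : X → X a continuous map. If f has the s-limit shadowing property, then f has the shadowing property. -/
open Filter Metric Set Topology

/-- A pseudo-orbit continued from time `n` on by a true orbit. -/
def continueByOrbit {X : Type*} (f : X → X) (x : ℕ → X) (n i : ℕ) : X :=
  f^[i - n] (x (min i n))

theorem continueByOrbit_of_le {X : Type*} (f : X → X) (x : ℕ → X) {n i : ℕ} (h : i ≤ n) :
    continueByOrbit f x n i = x i := by
  simp [continueByOrbit, h]

theorem continueByOrbit_succ_of_le {X : Type*} (f : X → X) (x : ℕ → X) {n i : ℕ} (h : n ≤ i) :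
    continueByOrbit f x n (i + 1) = f (continueByOrbit f x n i) := by
  rw [continueByOrbit, continueByOrbit, Nat.succ_sub h, Function.iterate_succ_apply',
    min_eq_right h, min_eq_right (h.trans i.le_succ)]

/-- In a compact space, shadowing finite initial segments suffices for shadowing a sequence. -/
theorem exists_shadowing_of_forall_initial {X : Type*} [MetricSpace X] [CompactSpace X]
    {f : X → X} (hf : Continuous f) {ε : ℝ} {x : ℕ → X}
    (h : ∀ n, ∃ z, ∀ i ≤ n, dist (f^[i] z) (x i) ≤ ε) :
    ∃ z, ∀ i, dist (f^[i] z) (x i) ≤ ε := by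
  choose z hz using h
  obtain ⟨w, φ, hφ, hw⟩ := CompactSpace.tendsto_subseq z
  refine ⟨w, fun i => ?_⟩
  refine le_of_tendsto ((((hf.iterate i).tendsto w).comp hw).dist tendsto_const_nhds) ?_
  filter_upwards [eventually_ge_atTop i] with n hn
  exact hz (φ n) i (hn.trans (hφ.id_le n))

/-- s-limit shadowing implies shadowing. -/
theorem shadowing_of_sLimitShadowing
    {X : Type*} [MetricSpace X] [CompactSpace X] (f : X → X) (hf : Continuous f)
    (hsls : SLimitShadowing f) : ShadowingProperty f := by
  intro ε hε
  obtain ⟨δ, hδ, H⟩ := hsls ε hε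
  refine ⟨δ, hδ, fun x hx => exists_shadowing_of_forall_initial hf fun n => ?_⟩
  have hδ_orbit : ∀ i, dist (f (continueByOrbit f x n i)) (continueByOrbit f x n (i + 1)) ≤ δ := by
    intro i
    rcases lt_or_ge i n with h | h
    · rw [continueByOrbit_of_le f x h.le, continueByOrbit_of_le f x h]
      exact hx i
    · rw [continueByOrbit_succ_of_le f x h, dist_self]
      exact hδ.le
  have h_lim : Tendsto (fun i => dist (f (continueByOrbit f x n i)) (continueByOrbit f x n (i + 1)))
      atTop (𝓝 0) := by
    refine tendsto_const_nhds.congr' ?_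
    filter_upwards [eventually_ge_atTop n] with i hi
    rw [continueByOrbit_succ_of_le f x hi, dist_self]
  obtain ⟨z, hz, -⟩ := H (continueByOrbit f x n) hδ_orbit h_lim
  refine ⟨z, fun i hi => ?_⟩
  rw [← continueByOrbit_of_le f x hi]
  exact hz i
end

section
/- Let X be a compact metric space and f : X → X a continuous map. If f has the s-limit shadowing property, then f has the limit shadowing property. -/
open Filter Metric Set Topology

theorem exists_forall_exists_dist_iterate_lt {X : Type*} [MetricSpace X] [CompactSpace X]
    {f : X → X} (hf : Continuous f) {δ : ℝ} (hδ : 0 < δ) :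
    ∃ m, ∀ x n, ∃ q, dist (f^[m] x) (f^[n] q) < δ := by
  have hanti : Antitone fun n => range f^[n] := by
    refine antitone_nat_of_succ_le fun n => ?_
    rintro _ ⟨y, rfl⟩
    exact ⟨f y, (Function.iterate_succ_apply f n y).symm⟩
  have hcompact : ∀ n, IsCompact (range f^[n]) := fun n => isCompact_range (hf.iterate n)
  obtain ⟨m, hm⟩ := exists_subset_nhds_of_isCompact' hanti.directed_ge hcompact
    (fun n => (hcompact n).isClosed) (U := thickening δ (⋂ n, range f^[n]))
    fun x hx => isOpen_thickening.mem_nhds (self_subset_thickening hδ _ hx)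
  refine ⟨m, fun x n => ?_⟩
  obtain ⟨z, hz, hxz⟩ := mem_thickening_iff.1 (hm ⟨x, rfl⟩)
  obtain ⟨q, rfl⟩ := mem_iInter.1 hz n
  exact ⟨q, hxz⟩

theorem tendsto_dist_iterate_of_tendsto_dist {X : Type*} [MetricSpace X] {f : X → X}
    (hf : UniformContinuous f) {x : ℕ → X}
    (hx : Tendsto (fun i => dist (f (x i)) (x (i + 1))) atTop (𝓝 0)) (m : ℕ) :
    Tendsto (fun i => dist (f^[m] (x i)) (x (i + m))) atTop (𝓝 0) := by
  induction m with
  | zero => simp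
  | succ m ih =>
    have hfm : Tendsto (fun i => dist (f (f^[m] (x i))) (f (x (i + m)))) atTop (𝓝 0) :=
      tendsto_uniformity_iff_dist_tendsto_zero.1 <| Tendsto.comp hf <|
        tendsto_uniformity_iff_dist_tendsto_zero (f := fun i => (f^[m] (x i), x (i + m))).2 ih
    have hsum := hfm.add (hx.comp (tendsto_add_atTop_nat m))
    rw [add_zero] at hsum
    refine squeeze_zero (fun _ => dist_nonneg) (fun i => ?_) hsum
    rw [Function.iterate_succ_apply']
    exact dist_triangle _ _ _

/-- s-limit shadowing implies limit shadowing. -/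
theorem limitShadowing_of_sLimitShadowing
    {X : Type*} [MetricSpace X] [CompactSpace X] (f : X → X) (hf : Continuous f)
    (hsls : SLimitShadowing f) : LimitShadowing f := by
  intro x hx
  obtain ⟨δ, hδ, hshadow⟩ := hsls 1 one_pos
  obtain ⟨m, hm⟩ := exists_forall_exists_dist_iterate_lt hf (half_pos hδ)
  have hiter := tendsto_dist_iterate_of_tendsto_dist
    (CompactSpace.uniformContinuous_of_continuous hf) hx m
  obtain ⟨N, hN⟩ := eventually_atTop.1
    ((hiter.eventually_lt_const (half_pos hδ)).and (hx.eventually_lt_const hδ))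
  obtain ⟨q, hq⟩ := hm (x N) (N + m)
  have hqx : dist (f^[N + m] q) (x (N + m)) ≤ δ := by
    have := dist_triangle_left (f^[N + m] q) (x (N + m)) (f^[m] (x N))
    linarith [(hN N le_rfl).1]
  let y : ℕ → X := fun i => if i < N + m then f^[i] q else x i
  have hyx : ∀ i, N + m ≤ i → y i = x i := fun i hi => if_neg hi.not_gt
  have hyq : ∀ i, i < N + m → y i = f^[i] q := fun i hi => if_pos hi
  obtain ⟨z, -, hz⟩ := hshadow y (fun i => by
    rcases lt_or_ge i (N + m) with hi | hi
    · rw [hyq i hi, ← Function.iterate_succ_apply' f]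
      rcases (Nat.succ_le_of_lt hi).lt_or_eq with hi' | hi'
      · rw [hyq _ hi', dist_self]
        exact hδ.le
      · rw [hyx _ hi'.ge, hi']
        exact hqx
    · rw [hyx i hi, hyx (i + 1) (by omega)]
      exact (hN i (by omega)).2.le)
    (hx.congr' <| (eventually_ge_atTop (N + m)).mono fun i hi => by
      beta_reduce
      rw [hyx i hi, hyx (i + 1) (by omega)])
  exact ⟨z, hz.congr' <| (eventually_ge_atTop (N + m)).mono fun i hi => by rw [hyx i hi]⟩
end

section
/- Let X be a compact metric space with metric d, let α > 1, and equip X^ℕ (sequences indexed by n ≥ 1) with the metric D(x,y) = sup_{n≥1} α^{−n} d(x_n, y_n); let σ : X^ℕ → X^ℕ be the shift map, σ((x_n)_{n≥1}) = (x_{n+1})_{n≥1}. Let ξ = (x^{(i)})_{i≥0} be a sequence of points of X^ℕ and set x = (x_1^{(n−1)})_{n≥1} ∈ X^ℕ. Then: (1) if lim_{i→∞} D(σ(x^{(i)}), x^{(i+1)}) = 0, then lim_{i→∞} D(σ^i(x), x^{(i)}) = 0; (2) for any δ > 0, if in addition D(σ(x^{(i)}), x^{(i+1)}) ≤ δ for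 all i ≥ 0, then D(σ^i(x), x^{(i)}) ≤ δ/(α−1) for all i ≥ 0. -/
open Filter Metric Set Topology

/-- The metric `D(x,y) = sup_{n≥1} α^{-n} d(x_n, y_n)` on `X^ℕ`, written with 0-based
indexing: the coordinate with index `n : ℕ` corresponds to the paper's index `n + 1`. -/
noncomputable def shiftDist {X : Type*} [MetricSpace X] (α : ℝ) (x y : ℕ → X) : ℝ :=
  ⨆ n : ℕ, α⁻¹ ^ (n + 1) * dist (x n) (y n)

/-- The shift map `σ : X^ℕ → X^ℕ`. -/
def shiftMap {X : Type*} (x : ℕ → X) : ℕ → X := fun n => x (n + 1)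

theorem shiftMap_iterate_apply {X : Type*} [MetricSpace X] (x : ℕ → X) (i n : ℕ) :
    shiftMap^[i] x n = x (i + n) := by
  induction i generalizing n with
  | zero => simp
  | succ i ih =>
    rw [Function.iterate_succ_apply', shiftMap, ih]
    congr 1
    omega

theorem shiftDist_nonneg {X : Type*} [MetricSpace X] {α : ℝ} (hα : 0 ≤ α) (x y : ℕ → X) :
    0 ≤ shiftDist α x y :=
  Real.iSup_nonneg fun _ => by positivity

theorem bddAbove_range_weighted_dist {X : Type*} [MetricSpace X] [CompactSpace X] {α : ℝ}
    (hα : 1 ≤ α) (x y : ℕ → X) :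
    BddAbove (range fun n : ℕ => α⁻¹ ^ (n + 1) * dist (x n) (y n)) := by
  refine ⟨diam (univ : Set X), ?_⟩
  rintro _ ⟨n, rfl⟩
  have hpow : α⁻¹ ^ (n + 1) ≤ 1 :=
    pow_le_one₀ (by positivity) (inv_le_one_of_one_le₀ hα)
  exact (mul_le_of_le_one_left dist_nonneg hpow).trans
    (dist_le_diam_of_mem isCompact_univ.isBounded (mem_univ _) (mem_univ _))

theorem dist_le_of_shiftDist_le {X : Type*} [MetricSpace X] [CompactSpace X] {α : ℝ}
    (hα : 1 ≤ α) {x y : ℕ → X} {δ : ℝ} (h : shiftDist α x y ≤ δ) (n : ℕ) :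
    dist (x n) (y n) ≤ α ^ (n + 1) * δ := by
  have hle := (le_ciSup (bddAbove_range_weighted_dist hα x y) n).trans h
  rwa [inv_pow, inv_mul_le_iff₀ (by positivity)] at hle

theorem shiftDist_le_of_dist_le {X : Type*} [MetricSpace X] {α : ℝ} (hα : 0 < α)
    {x y : ℕ → X} {δ : ℝ} (h : ∀ n, dist (x n) (y n) ≤ α ^ (n + 1) * δ) :
    shiftDist α x y ≤ δ :=
  ciSup_le fun n => by
    rw [inv_pow, inv_mul_le_iff₀ (by positivity)]
    exact h n

/-- A tail of a pseudo-orbit of the shift whose one-step errors are at most `δ` stays within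
`δ / (α - 1)` of the orbit of the sequence of zeroth coordinates. -/
theorem shiftDist_iterate_le {X : Type*} [MetricSpace X] [CompactSpace X] {α : ℝ} (hα : 1 < α)
    {ξ : ℕ → ℕ → X} {δ : ℝ} {i : ℕ}
    (h : ∀ j, i ≤ j → shiftDist α (shiftMap (ξ j)) (ξ (j + 1)) ≤ δ) :
    shiftDist α (shiftMap^[i] fun n => ξ n 0) (ξ i) ≤ δ / (α - 1) := by
  have hα' : 0 < α - 1 := sub_pos.2 hα
  have hδ : 0 ≤ δ := (shiftDist_nonneg (by linarith) _ _).trans (h i le_rfl)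
  refine shiftDist_le_of_dist_le (by linarith) fun n => ?_
  rw [shiftMap_iterate_apply]
  induction n generalizing i with
  | zero =>
    rw [add_zero, dist_self]
    positivity
  | succ n ih =>
    have htail := ih (i := i + 1) fun j hj => h j (by omega)
    have hstep : dist (ξ (i + 1) n) (ξ i (n + 1)) ≤ α ^ (n + 1) * δ := by
      rw [dist_comm]
      exact dist_le_of_shiftDist_le hα.le (h i le_rfl) n
    rw [show i + (n + 1) = i + 1 + n by omega]
    calc dist (ξ (i + 1 + n) 0) (ξ i (n + 1))
        ≤ dist (ξ (i + 1 + n) 0) (ξ (i + 1) n) + dist (ξ (i + 1) n) (ξ i (n + 1)) :=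
          dist_triangle _ _ _
      _ ≤ α ^ (n + 1) * (δ / (α - 1)) + α ^ (n + 1) * δ := add_le_add htail hstep
      _ = α ^ (n + 1 + 1) * (δ / (α - 1)) := by
          field_simp
          ring

/-- Lemma 4.1: for a sequence `ξ = (x^{(i)})_{i≥0}` in `X^ℕ` and
`x = (x₁^{(n-1)})_{n≥1}` (0-indexed: `x n = ξ n 0`):
(1) if `ξ` is a limit-pseudo orbit of `σ`, then `ξ` is limit shadowed by `x`;
(2) if moreover `ξ` is a δ-limit-pseudo orbit of `σ`, then `D(σⁱ(x), x^{(i)}) ≤ δ/(α-1)`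
for all `i ≥ 0`. -/
theorem shift_limit_shadowing_lemma
    {X : Type*} [MetricSpace X] [CompactSpace X] (α : ℝ) (hα : 1 < α)
    (ξ : ℕ → ℕ → X) (x : ℕ → X) (hx : x = fun n => ξ n 0) :
    (Tendsto (fun i => shiftDist α (shiftMap (ξ i)) (ξ (i + 1))) atTop (nhds 0) →
      Tendsto (fun i => shiftDist α (shiftMap^[i] x) (ξ i)) atTop (nhds 0)) ∧
    (∀ δ : ℝ, 0 < δ →
      (∀ i, shiftDist α (shiftMap (ξ i)) (ξ (i + 1)) ≤ δ) →
      Tendsto (fun i => shiftDist α (shiftMap (ξ i)) (ξ (i + 1))) atTop (nhds 0) →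
      ∀ i, shiftDist α (shiftMap^[i] x) (ξ i) ≤ δ / (α - 1)) := by
  subst hx
  have hα' : 0 < α - 1 := sub_pos.2 hα
  refine ⟨fun h => ?_, fun δ _ h _ i => shiftDist_iterate_le hα fun j _ => h j⟩
  refine tendsto_order.2 ⟨fun a ha => .of_forall fun i =>
    ha.trans_le (shiftDist_nonneg (by linarith) _ _), fun ε hε => ?_⟩
  have hpos : 0 < ε / 2 * (α - 1) := by positivity
  obtain ⟨N, hN⟩ := eventually_atTop.1 (h.eventually_le_const hpos)
  filter_upwards [eventually_ge_atTop N] with i hi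
  have hle := shiftDist_iterate_le hα fun j hj => hN j (hi.trans hj)
  rw [mul_div_cancel_right₀ _ hα'.ne'] at hle
  linarith
end
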